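/- arXiv:1310.6813 — 2 statements merged into one kernel-verified Lean document; each statement's English description precedes it below -/
import Mathlib

section
/- For every n ≥ 1, the Clifford group acts transitively on anticommuting pairs of self-inverse Pauli operators: if P, Q, P′, Q′ ∈ Pauli(n) satisfy P² = Q² = P′² = Q′² = I, PQ = −QP, and P′Q′ = −Q′P′, then there exists a Clifford operator C ∈ Clifford(n) with C P C⁻¹ = P′ and C Q C⁻¹ = Q′. -/
open scoped Matrix Kronecker

noncomputable section

def PX : Matrix (Fin 2) (Fin 2) ℂ := !![0, 1; 1, 0]
def PY : Matrix (Fin 2) (Fin 2) ℂ := !![0, -Complex.I; Complex.I, 0]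
def PZ : Matrix (Fin 2) (Fin 2) ℂ := !![1, 0; 0, -1]
def gH : Matrix (Fin 2) (Fin 2) ℂ := (Real.sqrt 2 : ℂ)⁻¹ • !![1, 1; 1, -1]
def gS : Matrix (Fin 2) (Fin 2) ℂ := !![1, 0; 0, Complex.I]
def gCZ : Matrix (Fin 4) (Fin 4) ℂ :=
  !![1,0,0,0; 0,1,0,0; 0,0,1,0; 0,0,0,-1]
def ω : ℂ := Complex.exp (Complex.I * Real.pi / 4)

/-- Kronecker product of square matrices, with index types flattened to `Fin (m * k)`. -/
def kron' {m k : ℕ} (A : Matrix (Fin m) (Fin m) ℂ) (B : Matrix (Fin k) (Fin k) ℂ) :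
    Matrix (Fin (m * k)) (Fin (m * k)) ℂ :=
  Matrix.reindex finProdFinEquiv finProdFinEquiv (A ⊗ₖ B)

/-- `n`-fold tensor product `P 0 ⊗ P 1 ⊗ ⋯ ⊗ P (n-1)` of 2×2 matrices. -/
def tensorPow : (n : ℕ) → (Fin n → Matrix (Fin 2) (Fin 2) ℂ) →
    Matrix (Fin (2 ^ n)) (Fin (2 ^ n)) ℂ
  | 0, _ => 1
  | n + 1, P =>
      Matrix.reindex (finCongr (pow_succ' 2 n).symm) (finCongr (pow_succ' 2 n).symm)
        (kron' (P 0) (tensorPow n fun i => P i.succ))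

/-- The set of n-qubit Pauli operators: λ • P₁ ⊗ ⋯ ⊗ Pₙ with λ ∈ {1,-1,i,-i},
    Pⱼ ∈ {I, X, Y, Z}. -/
def PauliSet (n : ℕ) : Set (Matrix (Fin (2 ^ n)) (Fin (2 ^ n)) ℂ) :=
  {M | ∃ (lam : ℂ) (P : Fin n → Matrix (Fin 2) (Fin 2) ℂ),
    lam ∈ ({1, -1, Complex.I, -Complex.I} : Set ℂ) ∧
    (∀ i, P i ∈ ({1, PX, PY, PZ} : Set (Matrix (Fin 2) (Fin 2) ℂ))) ∧
    M = lam • tensorPow n P}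

/-- `I_{2^a} ⊗ G ⊗ I_{2^b}`, where `G` acts on `c` qubits and `a + c + b = n`. -/
def embed (a c b n : ℕ) (h : a + c + b = n)
    (G : Matrix (Fin (2 ^ c)) (Fin (2 ^ c)) ℂ) :
    Matrix (Fin (2 ^ n)) (Fin (2 ^ n)) ℂ :=
  Matrix.reindex (finCongr (by subst h; rw [pow_add, pow_add, mul_assoc]))
    (finCongr (by subst h; rw [pow_add, pow_add, mul_assoc]))
    (kron' (1 : Matrix (Fin (2 ^ a)) (Fin (2 ^ a)) ℂ)
      (kron' G (1 : Matrix (Fin (2 ^ b)) (Fin (2 ^ b)) ℂ)))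

/-- Generators of the Clifford group: ω•I, and H, S, CZ applied to (adjacent) qubits. -/
def CliffordGenSet (n : ℕ) : Set (Matrix (Fin (2 ^ n)) (Fin (2 ^ n)) ℂ) :=
  {ω • 1} ∪
  {M | ∃ a b, ∃ h : a + 1 + b = n, M = embed a 1 b n h gH ∨ M = embed a 1 b n h gS} ∪
  {M | ∃ a b, ∃ h : a + 2 + b = n, M = embed a 2 b n h gCZ}

/-- The Clifford group on n qubits, as a subgroup of `GL (2^n) ℂ`. -/
def CliffordGroup (n : ℕ) : Subgroup (GL (Fin (2 ^ n)) ℂ) :=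
  Subgroup.closure
    {u : GL (Fin (2 ^ n)) ℂ | (u : Matrix (Fin (2 ^ n)) (Fin (2 ^ n)) ℂ) ∈ CliffordGenSet n}

/-- The Pauli group on n qubits, as a subgroup of `GL (2^n) ℂ`.
    (Its underlying set of matrices is exactly `PauliSet n`.) -/
def PauliGroup (n : ℕ) : Subgroup (GL (Fin (2 ^ n)) ℂ) :=
  Subgroup.closure
    {u : GL (Fin (2 ^ n)) ℂ | (u : Matrix (Fin (2 ^ n)) (Fin (2 ^ n)) ℂ) ∈ PauliSet n}

/-- Z on the first qubit, identity elsewhere. -/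
def ZFirst (n : ℕ) : Matrix (Fin (2 ^ n)) (Fin (2 ^ n)) ℂ :=
  tensorPow n fun i => if i.val = 0 then PZ else 1

/-- Z on the last qubit, identity elsewhere. -/
def ZLast (n : ℕ) : Matrix (Fin (2 ^ n)) (Fin (2 ^ n)) ℂ :=
  tensorPow n fun i => if i.val = n - 1 then PZ else 1

/-- X on the last qubit, identity elsewhere. -/
def XLast (n : ℕ) : Matrix (Fin (2 ^ n)) (Fin (2 ^ n)) ℂ :=
  tensorPow n fun i => if i.val = n - 1 then PX else 1


/-- The operator `A ⊗ M`, with `A` acting on a new first qubit. -/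
def consQubit {n : ℕ} (A : Matrix (Fin 2) (Fin 2) ℂ) (M : Matrix (Fin (2 ^ n)) (Fin (2 ^ n)) ℂ) :
    Matrix (Fin (2 ^ (n + 1))) (Fin (2 ^ (n + 1))) ℂ :=
  Matrix.reindex (finCongr (pow_succ' 2 n).symm) (finCongr (pow_succ' 2 n).symm) (kron' A M)

section ConsQubit

variable {n : ℕ} (A B : Matrix (Fin 2) (Fin 2) ℂ) (M N : Matrix (Fin (2 ^ n)) (Fin (2 ^ n)) ℂ)

lemma tensorPow_succ (P : Fin (n + 1) → Matrix (Fin 2) (Fin 2) ℂ) :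
    tensorPow (n + 1) P = consQubit (P 0) (tensorPow n fun i => P i.succ) := rfl

lemma consQubit_one_one : consQubit 1 (1 : Matrix (Fin (2 ^ n)) (Fin (2 ^ n)) ℂ) = 1 := by
  simp [consQubit, kron']

lemma consQubit_mul : consQubit A M * consQubit B N = consQubit (A * B) (M * N) := by
  simp only [consQubit, kron', Matrix.reindex_apply, Matrix.mul_kronecker_mul,
    Matrix.submatrix_mul_equiv]

lemma consQubit_smul_left (c : ℂ) : consQubit (c • A) M = c • consQubit A M := by
  ext; simp [consQubit, kron', mul_assoc]

lemma consQubit_smul_right (c : ℂ) : consQubit A (c • M) = c • consQubit A M := by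
  ext; simp [consQubit, kron', mul_left_comm]

lemma consQubit_neg_left : consQubit (-A) M = -consQubit A M := by
  ext; simp [consQubit, kron']

lemma consQubit_neg_right : consQubit A (-M) = -consQubit A M := by
  ext; simp [consQubit, kron']

lemma consQubit_add_right : consQubit A (M + N) = consQubit A M + consQubit A N := by
  ext; simp [consQubit, kron', mul_add]

lemma consQubit_add_left : consQubit (A + B) M = consQubit A M + consQubit B M := by
  ext; simp [consQubit, kron', add_mul]

lemma consQubit_one_embed (a c b : ℕ) (h : a + c + b = n)
    (G : Matrix (Fin (2 ^ c)) (Fin (2 ^ c)) ℂ) :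
    consQubit 1 (embed a c b n h G) = embed (a + 1) c b (n + 1) (by omega) G := by
  subst h
  have e : 2 ^ (a + c + b) = 2 ^ c * 2 ^ b * 2 ^ a := by ring
  have key : ∀ i j : ℕ, (i / 2 ^ (a + c + b) = j / 2 ^ (a + c + b) ∧
      i % 2 ^ (a + c + b) / (2 ^ c * 2 ^ b) = j % 2 ^ (a + c + b) / (2 ^ c * 2 ^ b)) ↔
      i / (2 ^ c * 2 ^ b) = j / (2 ^ c * 2 ^ b) := by
    intro i j
    rw [e]
    generalize 2 ^ c * 2 ^ b = m
    rw [← Nat.div_div_eq_div_mul, ← Nat.div_div_eq_div_mul, Nat.mod_mul_right_div_self,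
      Nat.mod_mul_right_div_self]
    constructor
    · rintro ⟨h1, h2⟩
      rw [← Nat.div_add_mod (i / m) (2 ^ a), h1, h2, Nat.div_add_mod]
    · intro h; rw [h]; exact ⟨rfl, rfl⟩
  have hm : ∀ i : ℕ, i % 2 ^ (a + c + b) % (2 ^ c * 2 ^ b) = i % (2 ^ c * 2 ^ b) := by
    intro i; rw [e, Nat.mod_mul_right_mod]
  ext i j
  simp only [consQubit, embed, kron', Matrix.reindex_apply, Matrix.submatrix_apply,
    Matrix.kroneckerMap_apply, Matrix.one_apply, finProdFinEquiv_symm_apply, ← mul_assoc,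
    Fin.ext_iff, Fin.modNat, Fin.divNat, finCongr_symm, finCongr_apply, Fin.val_cast, hm,
    ← key i j]
  split_ifs <;> simp_all

lemma embed_zero_one (G : Matrix (Fin 2) (Fin 2) ℂ) :
    embed 0 1 n (n + 1) (by omega) G = consQubit G 1 := by
  ext i j
  have hi : (i : ℕ) < 2 * 2 ^ n := (pow_succ' 2 n) ▸ i.2
  have hj : (j : ℕ) < 2 * 2 ^ n := (pow_succ' 2 n) ▸ j.2
  simp [consQubit, embed, kron', Matrix.one_apply, Fin.modNat, Fin.divNat,
    Nat.mod_eq_of_lt, Nat.div_eq_of_lt, hi, hj]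

lemma embed_zero_two :
    embed 0 2 n (n + 2) (by omega) (Matrix.reindex finProdFinEquiv finProdFinEquiv (A ⊗ₖ B)) =
      consQubit A (consQubit B (1 : Matrix (Fin (2 ^ n)) (Fin (2 ^ n)) ℂ)) := by
  ext i j
  have e : 2 * 2 * 2 ^ n = 2 ^ (n + 2) := by ring
  have hi : (i : ℕ) < 2 * 2 * 2 ^ n := by rw [e]; exact i.2
  have hj : (j : ℕ) < 2 * 2 * 2 ^ n := by rw [e]; exact j.2
  have hi' : (i : ℕ) < 4 * 2 ^ n := by omega
  have hj' : (j : ℕ) < 4 * 2 ^ n := by omega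
  have h1 : ∀ k : ℕ, k % 2 ^ (n + 1) % 2 ^ n = k % 2 ^ n := by
    intro k; rw [pow_succ, Nat.mod_mul_right_mod]
  have h2 : ∀ k : ℕ, k % 2 ^ (n + 1) / 2 ^ n = k / 2 ^ n % 2 := by
    intro k; rw [pow_succ, Nat.mod_mul_right_div_self]
  have h3 : ∀ k : ℕ, k / 2 ^ (n + 1) = k / 2 ^ n / 2 := by
    intro k; rw [pow_succ, Nat.div_div_eq_div_mul]
  simp only [consQubit, embed, kron', Matrix.reindex_apply, Matrix.submatrix_apply,
    Matrix.kroneckerMap_apply, Matrix.one_apply, finProdFinEquiv_symm_apply, Fin.ext_iff,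
    Fin.modNat, Fin.divNat, finCongr_symm, finCongr_apply, Fin.val_cast, h1, h2, h3,
    Nat.reducePow, Nat.mod_eq_of_lt, Nat.div_eq_of_lt, hi', hj', if_true, one_mul, mul_one,
    mul_ite, mul_zero]

end ConsQubit

lemma reindex_kronecker_two (A B : Matrix (Fin 2) (Fin 2) ℂ) :
    Matrix.reindex finProdFinEquiv finProdFinEquiv (A ⊗ₖ B) =
      (!![A 0 0 * B 0 0, A 0 0 * B 0 1, A 0 1 * B 0 0, A 0 1 * B 0 1;
         A 0 0 * B 1 0, A 0 0 * B 1 1, A 0 1 * B 1 0, A 0 1 * B 1 1;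
         A 1 0 * B 0 0, A 1 0 * B 0 1, A 1 1 * B 0 0, A 1 1 * B 0 1;
         A 1 0 * B 1 0, A 1 0 * B 1 1, A 1 1 * B 1 0, A 1 1 * B 1 1] :
        Matrix (Fin (2 * 2)) (Fin (2 * 2)) ℂ) := by
  ext i j
  change Fin 4 at i j
  fin_cases i <;> fin_cases j <;> rfl

lemma gCZ_eq : gCZ = (1 / 2 : ℂ) • (Matrix.reindex finProdFinEquiv finProdFinEquiv (1 ⊗ₖ 1) +
    Matrix.reindex finProdFinEquiv finProdFinEquiv (PZ ⊗ₖ 1) +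
    Matrix.reindex finProdFinEquiv finProdFinEquiv (1 ⊗ₖ PZ) -
    Matrix.reindex finProdFinEquiv finProdFinEquiv (PZ ⊗ₖ PZ) :
      Matrix (Fin (2 * 2)) (Fin (2 * 2)) ℂ) := by
  simp only [reindex_kronecker_two]
  ext i j
  change Fin 4 at i j
  fin_cases i <;> fin_cases j <;> simp [gCZ, PZ] <;> norm_num

lemma embed_gCZ (n : ℕ) : embed 0 2 n (n + 2) (by omega) gCZ = (1 / 2 : ℂ) •
    (1 + consQubit PZ 1 + consQubit 1 (consQubit PZ 1) - consQubit PZ (consQubit PZ 1)) := by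
  have hs : ∀ (c : ℂ) M, embed 0 2 n (n + 2) (by omega) (c • M) =
      c • embed 0 2 n (n + 2) (by omega) M := by
    intro c M
    ext
    simp only [embed, kron', Matrix.smul_kronecker, Matrix.kronecker_smul, Matrix.reindex_apply,
      Matrix.submatrix_smul, Pi.smul_apply, Matrix.smul_apply]
  have ha : ∀ M N, embed 0 2 n (n + 2) (by omega) (M + N) =
      embed 0 2 n (n + 2) (by omega) M + embed 0 2 n (n + 2) (by omega) N := by
    intro M N
    simp only [embed, kron', Matrix.add_kronecker, Matrix.kronecker_add, Matrix.reindex_apply,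
      Matrix.submatrix_add, Pi.add_apply]
  have hd : ∀ M N, embed 0 2 n (n + 2) (by omega) (M - N) =
      embed 0 2 n (n + 2) (by omega) M - embed 0 2 n (n + 2) (by omega) N := by
    intro M N
    rw [eq_sub_iff_add_eq, ← ha, sub_add_cancel]
  rw [gCZ_eq, hs, hd, ha, ha]
  have h1 := embed_zero_two (n := n) 1 1
  rw [consQubit_one_one, consQubit_one_one] at h1
  exact congrArg _ (congrArg₂ _ (congrArg₂ _ (congrArg₂ _ h1
    ((embed_zero_two PZ 1).trans (by rw [consQubit_one_one])))
    (embed_zero_two 1 PZ)) (embed_zero_two PZ PZ))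

lemma inv_sqrt_two_mul_self : ((Real.sqrt 2 : ℂ)⁻¹) * (Real.sqrt 2 : ℂ)⁻¹ = 1 / 2 := by
  rw [← mul_inv, ← Complex.ofReal_mul, Real.mul_self_sqrt (by norm_num)]
  norm_num

lemma ω_eq : ω = (Real.sqrt 2 : ℂ)⁻¹ * (1 + Complex.I) := by
  have h : ω = Complex.exp (((Real.pi / 4 : ℝ) : ℂ) * Complex.I) := by
    rw [ω]; congr 1; push_cast; ring
  have hs : ((Real.sqrt 2 / 2 : ℝ) : ℂ) = (Real.sqrt 2 : ℂ)⁻¹ := by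
    rw [← Complex.ofReal_inv]
    congr 1
    rw [← Real.sqrt_div_self]
  rw [h, Complex.exp_mul_I, ← Complex.ofReal_cos, ← Complex.ofReal_sin, Real.cos_pi_div_four,
    Real.sin_pi_div_four, hs]
  ring

lemma ω_mul_inv : ω * ((Real.sqrt 2 : ℂ)⁻¹ * (1 - Complex.I)) = 1 := by
  rw [ω_eq]
  linear_combination (1 - Complex.I * Complex.I) * inv_sqrt_two_mul_self -
    (1 / 2) * Complex.I_mul_I

section Clifford

variable {n : ℕ}

lemma exists_mem_cliffordGroup {M N : Matrix (Fin (2 ^ n)) (Fin (2 ^ n)) ℂ}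
    (hM : M ∈ CliffordGenSet n) (h : M * N = 1) :
    ∃ u ∈ CliffordGroup n, (u : Matrix (Fin (2 ^ n)) (Fin (2 ^ n)) ℂ) = M ∧
      ((u⁻¹ : GL (Fin (2 ^ n)) ℂ) : Matrix (Fin (2 ^ n)) (Fin (2 ^ n)) ℂ) = N :=
  ⟨⟨M, N, h, mul_eq_one_comm.mp h⟩, Subgroup.subset_closure hM, rfl, rfl⟩

/-- Tensoring with the identity on a new first qubit, as a monoid homomorphism. -/
def consOneHom (n : ℕ) : Matrix (Fin (2 ^ n)) (Fin (2 ^ n)) ℂ →*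
    Matrix (Fin (2 ^ (n + 1))) (Fin (2 ^ (n + 1))) ℂ where
  toFun := consQubit 1
  map_one' := consQubit_one_one
  map_mul' M N := by rw [consQubit_mul, one_mul]

lemma map_consOneHom_mem_cliffordGroup {u : GL (Fin (2 ^ n)) ℂ} (hu : u ∈ CliffordGroup n) :
    Units.map (consOneHom n) u ∈ CliffordGroup (n + 1) := by
  suffices h : CliffordGroup n ≤ (CliffordGroup (n + 1)).comap (Units.map (consOneHom n)) from h hu
  refine (Subgroup.closure_le _).mpr fun v hv => Subgroup.subset_closure ?_
  change consQubit 1 (v : Matrix (Fin (2 ^ n)) (Fin (2 ^ n)) ℂ) ∈ CliffordGenSet (n + 1)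
  rcases hv with (hv | ⟨a, b, h, hv⟩) | ⟨a, b, h, hv⟩
  · rw [Set.mem_singleton_iff] at hv
    rw [hv, consQubit_smul_right, consQubit_one_one]
    exact Or.inl (Or.inl rfl)
  · refine Or.inl (Or.inr ⟨a + 1, b, by omega, ?_⟩)
    rcases hv with hv | hv
    · exact Or.inl (by rw [hv, consQubit_one_embed])
    · exact Or.inr (by rw [hv, consQubit_one_embed])
  · exact Or.inr ⟨a + 1, b, by omega, by rw [hv, consQubit_one_embed]⟩

/-- `M` is an involution whose rotation `(1 + i M) / √2` is a Clifford operator. -/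
def HasCliffordRotation (n : ℕ) (M : Matrix (Fin (2 ^ n)) (Fin (2 ^ n)) ℂ) : Prop :=
  M * M = 1 ∧ ∃ u ∈ CliffordGroup n,
    (u : Matrix (Fin (2 ^ n)) (Fin (2 ^ n)) ℂ) = (Real.sqrt 2 : ℂ)⁻¹ • (1 + Complex.I • M)

lemma rotation_mul_rotation_neg {M : Matrix (Fin (2 ^ n)) (Fin (2 ^ n)) ℂ} (h : M * M = 1) :
    ((Real.sqrt 2 : ℂ)⁻¹ • (1 + Complex.I • M)) * ((Real.sqrt 2 : ℂ)⁻¹ • (1 + Complex.I • -M)) =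
      1 := by
  rw [smul_mul_smul_comm, inv_sqrt_two_mul_self]
  simp only [mul_add, add_mul, mul_one, one_mul, smul_neg, mul_neg, smul_mul_smul_comm, h,
    Complex.I_mul_I]
  module

namespace HasCliffordRotation

variable {A B M : Matrix (Fin (2 ^ n)) (Fin (2 ^ n)) ℂ}

lemma one (n : ℕ) : HasCliffordRotation n 1 := by
  obtain ⟨u, hu, h, -⟩ := exists_mem_cliffordGroup (n := n) (Or.inl (Or.inl rfl))
    (N := ((Real.sqrt 2 : ℂ)⁻¹ * (1 - Complex.I)) • 1)
    (by rw [smul_mul_smul_comm, ω_mul_inv, one_smul, one_mul])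
  refine ⟨one_mul 1, u, hu, ?_⟩
  rw [h, ω_eq]
  module

lemma neg (h : HasCliffordRotation n M) : HasCliffordRotation n (-M) := by
  obtain ⟨h2, u, hu, h⟩ := h
  refine ⟨by rw [neg_mul_neg, h2], u⁻¹, inv_mem hu, ?_⟩
  exact Units.inv_eq_of_mul_eq_one_right (by rw [h, rotation_mul_rotation_neg h2])

lemma of_conj (hA : HasCliffordRotation n A) {u : GL (Fin (2 ^ n)) ℂ} (hu : u ∈ CliffordGroup n)
    (h : (u : Matrix (Fin (2 ^ n)) (Fin (2 ^ n)) ℂ) * A = B * u) : HasCliffordRotation n B := by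
  obtain ⟨h2, v, hv, hvA⟩ := hA
  have hB : B = u * A * (u⁻¹ : GL (Fin (2 ^ n)) ℂ) := by rw [h, mul_assoc, u.mul_inv, mul_one]
  refine ⟨?_, u * v * u⁻¹, mul_mem (mul_mem hu hv) (inv_mem hu), ?_⟩
  · calc B * B = B * u * A * (u⁻¹ : GL (Fin (2 ^ n)) ℂ) := by
          nth_rw 2 [hB]; simp only [mul_assoc]
      _ = 1 := by rw [← h, mul_assoc _ A A, h2, mul_one, u.mul_inv]
  · rw [Units.val_mul, Units.val_mul, hvA, hB]
    simp only [mul_add, add_mul, smul_mul_assoc, mul_smul_comm, mul_one, u.mul_inv]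

lemma mul (hA : HasCliffordRotation n A) (hB : HasCliffordRotation n B)
    (h : A * B = -(B * A)) : HasCliffordRotation n (Complex.I • (A * B)) := by
  obtain ⟨hA2, u, hu, huA⟩ := hA
  refine hB.of_conj hu ?_
  have hABA : A * (B * A) = -B := by
    rw [← mul_assoc, h, neg_mul, mul_assoc, hA2, mul_one]
  rw [huA]
  simp only [mul_add, add_mul, smul_mul_assoc, mul_smul_comm, mul_one, one_mul, mul_assoc, hABA,
    smul_smul]
  congr 1
  simp only [smul_neg, Complex.I_mul_I]
  module

lemma consQubit_one (h : HasCliffordRotation n M) : HasCliffordRotation (n + 1) (consQubit 1 M) := by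
  obtain ⟨h2, u, hu, h⟩ := h
  refine ⟨by rw [consQubit_mul, h2, one_mul, consQubit_one_one], _,
    map_consOneHom_mem_cliffordGroup hu, ?_⟩
  change consQubit 1 (u : Matrix (Fin (2 ^ n)) (Fin (2 ^ n)) ℂ) = _
  rw [h, consQubit_smul_right, consQubit_add_right, consQubit_one_one, consQubit_smul_right]

end HasCliffordRotation

lemma PX_mul_PX : PX * PX = 1 := by
  ext i j; fin_cases i <;> fin_cases j <;> simp [PX]

lemma PZ_mul_PZ : PZ * PZ = 1 := by
  ext i j; fin_cases i <;> fin_cases j <;> simp [PZ]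

lemma PY_mul_PY : PY * PY = 1 := by
  ext i j; fin_cases i <;> fin_cases j <;> simp [PY]

lemma PX_mul_PY : PX * PY = Complex.I • PZ := by
  ext i j; fin_cases i <;> fin_cases j <;> simp [PX, PY, PZ]

lemma PY_mul_PX : PY * PX = -(Complex.I • PZ) := by
  ext i j; fin_cases i <;> fin_cases j <;> simp [PX, PY, PZ]

lemma PY_mul_PZ : PY * PZ = Complex.I • PX := by
  ext i j; fin_cases i <;> fin_cases j <;> simp [PX, PY, PZ]

lemma PZ_mul_PY : PZ * PY = -(Complex.I • PX) := by
  ext i j; fin_cases i <;> fin_cases j <;> simp [PX, PY, PZ]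

lemma PZ_mul_PX : PZ * PX = Complex.I • PY := by
  ext i j; fin_cases i <;> fin_cases j <;> simp [PX, PY, PZ]

lemma PX_mul_PZ : PX * PZ = -(Complex.I • PY) := by
  ext i j; fin_cases i <;> fin_cases j <;> simp [PX, PY, PZ]

lemma gH_mul_gH : gH * gH = 1 := by
  rw [gH, smul_mul_smul_comm, inv_sqrt_two_mul_self]
  ext i j; fin_cases i <;> fin_cases j <;> simp <;> norm_num

lemma gH_mul_PZ : gH * PZ = PX * gH := by
  rw [gH, smul_mul_assoc, mul_smul_comm]
  congr 1
  ext i j; fin_cases i <;> fin_cases j <;> simp [PX, PZ]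

lemma gS_mul_gS : gS * gS = PZ := by
  ext i j; fin_cases i <;> fin_cases j <;> simp [gS, PZ]

lemma ω_smul_PZ_mul_gS :
    ω • (PZ * gS) = (Real.sqrt 2 : ℂ)⁻¹ • (1 + Complex.I • PZ) := by
  rw [ω_eq]
  ext i j
  fin_cases i <;> fin_cases j <;> simp [gS, PZ]
  linear_combination (-(Real.sqrt 2 : ℂ)⁻¹) * Complex.I_mul_I

namespace HasCliffordRotation

lemma consQubit_PZ_one (n : ℕ) : HasCliffordRotation (n + 1) (consQubit PZ 1) := by
  obtain ⟨u, hu, h, -⟩ := exists_mem_cliffordGroup (n := n + 1) (Or.inl (Or.inl rfl))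
    (N := ((Real.sqrt 2 : ℂ)⁻¹ * (1 - Complex.I)) • 1)
    (by rw [smul_mul_smul_comm, ω_mul_inv, one_smul, one_mul])
  obtain ⟨v, hv, h', -⟩ := exists_mem_cliffordGroup (n := n + 1) (M := consQubit gS 1)
    (Or.inl (Or.inr ⟨0, n, by omega, Or.inr (embed_zero_one gS).symm⟩))
    (N := consQubit (gS * PZ) 1)
    (by rw [consQubit_mul, ← mul_assoc, gS_mul_gS, PZ_mul_PZ, one_mul, consQubit_one_one])
  refine ⟨by rw [consQubit_mul, PZ_mul_PZ, one_mul, consQubit_one_one], u * (v * v * v),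
    mul_mem hu (mul_mem (mul_mem hv hv) hv), ?_⟩
  simp only [Units.val_mul, h, h', consQubit_mul, smul_mul_assoc, one_mul, gS_mul_gS]
  rw [← consQubit_smul_left, ω_smul_PZ_mul_gS, consQubit_smul_left, consQubit_add_left,
    consQubit_smul_left, consQubit_one_one]

lemma consQubit_PX_one (n : ℕ) : HasCliffordRotation (n + 1) (consQubit PX 1) := by
  obtain ⟨u, hu, h, -⟩ := exists_mem_cliffordGroup (n := n + 1) (M := consQubit gH 1)
    (Or.inl (Or.inr ⟨0, n, by omega, Or.inl (embed_zero_one gH).symm⟩))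
    (N := consQubit gH 1)
    (by rw [consQubit_mul, gH_mul_gH, one_mul, consQubit_one_one])
  refine (consQubit_PZ_one n).of_conj hu ?_
  rw [h, consQubit_mul, consQubit_mul, gH_mul_PZ]

end HasCliffordRotation

lemma controlledZ_mul_controlledZ {R : Type*} [Ring R] [Algebra ℂ R] {A B : R} (hA : A * A = 1)
    (hB : B * B = 1) (h : A * B = B * A) :
    ((1 / 2 : ℂ) • (1 + A + B - A * B)) * ((1 / 2 : ℂ) • (1 + A + B - A * B)) = 1 := by
  have h1 : B * (A * B) = A := by rw [h, ← mul_assoc, hB, one_mul]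
  have h2 : A * (A * B) = B := by rw [← mul_assoc, hA, one_mul]
  rw [smul_mul_smul_comm]
  simp only [mul_add, add_mul, mul_sub, sub_mul, mul_one, one_mul, mul_assoc, hA, hB, ← h, h1, h2]
  module

lemma controlledZ_mul_rotations {R : Type*} [Ring R] [Algebra ℂ R] {A B : R} (hA : A * A = 1)
    (hB : B * B = 1) (h : A * B = B * A) :
    ((1 / 2 : ℂ) • (1 + A + B - A * B)) * ((1 + Complex.I • A) * (1 + Complex.I • B)) =
      (1 + Complex.I) • (1 + Complex.I • (A * B)) := by
  have h1 : B * (A * B) = A := by rw [h, ← mul_assoc, hB, one_mul]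
  have h2 : A * (A * B) = B := by rw [← mul_assoc, hA, one_mul]
  simp only [mul_add, add_mul, sub_mul, smul_mul_assoc, mul_smul_comm, mul_one, one_mul,
    mul_assoc, hA, hB, ← h, h1, h2, smul_smul, Complex.I_mul_I, add_smul, smul_add, smul_sub]
  match_scalars
  all_goals ring

namespace HasCliffordRotation

lemma consQubit_PZ_consQubit_PZ_one (n : ℕ) :
    HasCliffordRotation (n + 2) (consQubit PZ (consQubit PZ 1)) := by
  have hAB : consQubit PZ (consQubit PZ 1) = (consQubit PZ 1 : Matrix (Fin (2 ^ (n + 2))) _ ℂ) *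
      consQubit 1 (consQubit PZ 1) := by rw [consQubit_mul, one_mul, mul_one]
  obtain ⟨hA, u, hu, huA⟩ := consQubit_PZ_one (n + 1)
  obtain ⟨hB, v, hv, hvB⟩ := (consQubit_PZ_one n).consQubit_one
  have hcomm : (consQubit PZ 1 : Matrix (Fin (2 ^ (n + 2))) _ ℂ) * consQubit 1 (consQubit PZ 1) =
      consQubit 1 (consQubit PZ 1) * consQubit PZ 1 := by
    simp only [consQubit_mul, one_mul, mul_one]
  obtain ⟨w, hw, hwM, -⟩ := exists_mem_cliffordGroup (n := n + 2)
    (Or.inr ⟨0, n, by omega, rfl⟩)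
    (N := embed 0 2 n (n + 2) (by omega) gCZ)
    (by rw [embed_gCZ, hAB, controlledZ_mul_controlledZ hA hB hcomm])
  obtain ⟨x, hx, -, hxM⟩ := exists_mem_cliffordGroup (n := n + 2) (Or.inl (Or.inl rfl))
    (N := ((Real.sqrt 2 : ℂ)⁻¹ * (1 - Complex.I)) • 1)
    (by rw [smul_mul_smul_comm, ω_mul_inv, one_smul, one_mul])
  refine ⟨by simp only [consQubit_mul, PZ_mul_PZ, one_mul, consQubit_one_one],
    x⁻¹ * (w * (u * v)), mul_mem (inv_mem hx) (mul_mem hw (mul_mem hu hv)), ?_⟩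
  rw [Units.val_mul, Units.val_mul, Units.val_mul, hxM, hwM, huA, hvB, embed_gCZ,
    smul_mul_smul_comm _ _ (Real.sqrt 2 : ℂ)⁻¹, inv_sqrt_two_mul_self, mul_smul_comm, hAB,
    controlledZ_mul_rotations hA hB hcomm, smul_mul_assoc, one_mul, smul_smul, smul_smul]
  congr 1
  linear_combination (-(1 / 2) * (Real.sqrt 2 : ℂ)⁻¹) * Complex.I_mul_I

end HasCliffordRotation

/-- The one-qubit Pauli letters. -/
def pauliLetters : Set (Matrix (Fin 2) (Fin 2) ℂ) := {1, PX, PY, PZ}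

lemma exists_anticommuting_factorization {A : Matrix (Fin 2) (Fin 2) ℂ} (hA : A ∈ pauliLetters)
    (h1 : A ≠ 1) : ∃ B ∈ pauliLetters, ∃ C ∈ pauliLetters, B ≠ 1 ∧ C ≠ 1 ∧
      B * C = -(C * B) ∧ A = Complex.I • (B * C) := by
  have hX : PX ≠ 1 := fun h => by simpa [PX] using congrFun₂ h 0 0
  have hY : PY ≠ 1 := fun h => by simpa [PY] using congrFun₂ h 0 0
  have hZ : PZ ≠ 1 := fun h => by
    have := congrFun₂ h 1 1
    norm_num [PZ] at this
  rcases hA with h | h | h | h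
  · exact absurd h h1
  · refine ⟨PZ, by simp [pauliLetters], PY, by simp [pauliLetters], hZ, hY, ?_, ?_⟩
    · rw [PZ_mul_PY, PY_mul_PZ]
    · rw [h, PZ_mul_PY, smul_neg, smul_smul, Complex.I_mul_I]; simp
  · refine ⟨PX, by simp [pauliLetters], PZ, by simp [pauliLetters], hX, hZ, ?_, ?_⟩
    · rw [PX_mul_PZ, PZ_mul_PX]
    · rw [h, PX_mul_PZ, smul_neg, smul_smul, Complex.I_mul_I]; simp
  · refine ⟨PY, by simp [pauliLetters], PX, by simp [pauliLetters], hY, hX, ?_, ?_⟩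
    · rw [PX_mul_PY, PY_mul_PX]
    · rw [h, PY_mul_PX, smul_neg, smul_smul, Complex.I_mul_I]; simp

namespace HasCliffordRotation

lemma consQubit_of_PZ {M : Matrix (Fin (2 ^ n)) (Fin (2 ^ n)) ℂ}
    (h : HasCliffordRotation (n + 1) (consQubit PZ M)) {A : Matrix (Fin 2) (Fin 2) ℂ}
    (hA : A ∈ pauliLetters) (h1 : A ≠ 1) : HasCliffordRotation (n + 1) (consQubit A M) := by
  have hY : HasCliffordRotation (n + 1) (consQubit PY M) := by
    have := (consQubit_PX_one n).mul h (by
      rw [consQubit_mul, consQubit_mul, PX_mul_PZ, PZ_mul_PX, one_mul, mul_one, consQubit_neg_left])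
    rw [consQubit_mul, PX_mul_PZ, one_mul, consQubit_neg_left, consQubit_smul_left, smul_neg,
      smul_smul, Complex.I_mul_I] at this
    simpa using this
  have hY1 : HasCliffordRotation (n + 1) (consQubit PY 1) := by
    have := (consQubit_PX_one n).mul (consQubit_PZ_one n) (by
      rw [consQubit_mul, consQubit_mul, PX_mul_PZ, PZ_mul_PX, consQubit_neg_left])
    rw [consQubit_mul, PX_mul_PZ, one_mul, consQubit_neg_left, consQubit_smul_left, smul_neg,
      smul_smul, Complex.I_mul_I] at this
    simpa using this
  rcases hA with rfl | rfl | rfl | rfl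
  · exact absurd rfl h1
  · have := h.mul hY1 (by
      rw [consQubit_mul, consQubit_mul, PY_mul_PZ, PZ_mul_PY, one_mul, mul_one, consQubit_neg_left])
    rw [consQubit_mul, PZ_mul_PY, mul_one, consQubit_neg_left, consQubit_smul_left, smul_neg,
      smul_smul, Complex.I_mul_I] at this
    simpa using this
  · exact hY
  · exact h

lemma consQubit_letter_one (n : ℕ) {A : Matrix (Fin 2) (Fin 2) ℂ} (hA : A ∈ pauliLetters) :
    HasCliffordRotation (n + 1) (consQubit A 1) := by
  by_cases h1 : A = 1
  · rw [h1, consQubit_one_one]; exact one _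
  · exact (consQubit_PZ_one n).consQubit_of_PZ hA h1

lemma consQubit_letter_consQubit_letter_one (n : ℕ) {A B : Matrix (Fin 2) (Fin 2) ℂ}
    (hA : A ∈ pauliLetters) (hA1 : A ≠ 1) (hB : B ∈ pauliLetters) :
    HasCliffordRotation (n + 2) (consQubit A (consQubit B 1)) := by
  have hZ := (consQubit_PZ_consQubit_PZ_one n).consQubit_of_PZ hA hA1
  have hX := (consQubit_PX_one n).consQubit_one
  have hY : HasCliffordRotation (n + 2) (consQubit A (consQubit PY 1)) := by
    have := hX.mul hZ (by
      simp only [consQubit_mul, PX_mul_PZ, PZ_mul_PX, one_mul, mul_one, consQubit_neg_left,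
        consQubit_neg_right])
    simp only [consQubit_mul, PX_mul_PZ, one_mul, consQubit_neg_left, consQubit_neg_right,
      consQubit_smul_left, consQubit_smul_right, smul_neg, smul_smul, Complex.I_mul_I] at this
    simpa using this
  rcases hB with rfl | rfl | rfl | rfl
  · rw [consQubit_one_one]; exact consQubit_letter_one _ hA
  · have := (consQubit_PZ_one n).consQubit_one.mul hY (by
      simp only [consQubit_mul, PZ_mul_PY, PY_mul_PZ, one_mul, mul_one, consQubit_neg_left,
        consQubit_neg_right])
    simp only [consQubit_mul, PZ_mul_PY, one_mul, consQubit_neg_left, consQubit_neg_right,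
      consQubit_smul_left, consQubit_smul_right, smul_neg, smul_smul, Complex.I_mul_I] at this
    simpa using this
  · exact hY
  · exact hZ

lemma consQubit_consQubit {M : Matrix (Fin (2 ^ n)) (Fin (2 ^ n)) ℂ}
    (hM : ∀ B ∈ pauliLetters, HasCliffordRotation (n + 1) (consQubit B M))
    {A B : Matrix (Fin 2) (Fin 2) ℂ} (hA : A ∈ pauliLetters) (hB : B ∈ pauliLetters) :
    HasCliffordRotation (n + 2) (consQubit A (consQubit B M)) := by
  have key : ∀ {A B : Matrix (Fin 2) (Fin 2) ℂ}, A ∈ pauliLetters → A ≠ 1 → B ∈ pauliLetters →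
      B ≠ 1 → HasCliffordRotation (n + 2) (consQubit A (consQubit B M)) := by
    intro A B hA hA1 hB hB1
    obtain ⟨C, hC, D, hD, -, -, hCD, rfl⟩ := exists_anticommuting_factorization hB hB1
    have := (consQubit_letter_consQubit_letter_one n hA hA1 hC).mul (hM D hD).consQubit_one (by
      simp only [consQubit_mul, one_mul, mul_one, hCD, consQubit_neg_left, consQubit_neg_right])
    simpa only [consQubit_mul, one_mul, mul_one, consQubit_smul_left, consQubit_smul_right]
      using this
  by_cases hA1 : A = 1
  · rw [hA1]; exact (hM B hB).consQubit_one
  by_cases hB1 : B = 1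
  · obtain ⟨C, hC, D, hD, hC1, hD1, hCD, rfl⟩ := exists_anticommuting_factorization hA hA1
    have hX : PX ≠ 1 := fun h => by simpa [PX] using congrFun₂ h 0 0
    have hXm : PX ∈ pauliLetters := by simp [pauliLetters]
    have := (key hC hC1 hXm hX).mul (consQubit_letter_consQubit_letter_one n hD hD1 hXm) (by
      simp only [consQubit_mul, one_mul, mul_one, hCD, consQubit_neg_left])
    simpa only [hB1, consQubit_mul, one_mul, mul_one, PX_mul_PX, consQubit_smul_left] using this
  · exact key hA hA1 hB hB1

lemma tensorPow : ∀ (n : ℕ) (P : Fin n → Matrix (Fin 2) (Fin 2) ℂ) (_ : ∀ i, P i ∈ pauliLetters),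
    HasCliffordRotation n (tensorPow n P)
  | 0, _, _ => one 0
  | 1, _, hP => consQubit_letter_one 0 (hP 0)
  | n + 2, P, hP => by
    rw [tensorPow_succ, tensorPow_succ]
    refine consQubit_consQubit (fun B hB => ?_) (hP _) (hP _)
    have := tensorPow (n + 1) (Fin.cons B fun i => P i.succ.succ)
      (Fin.cases hB fun i => hP i.succ.succ)
    rwa [tensorPow_succ] at this

lemma of_mem_pauliSet {M : Matrix (Fin (2 ^ n)) (Fin (2 ^ n)) ℂ} (hM : M ∈ PauliSet n)
    (h2 : M * M = 1) : HasCliffordRotation n M := by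
  obtain ⟨c, P, -, hP, rfl⟩ := hM
  have hT := tensorPow n P hP
  rw [smul_mul_smul_comm, hT.1] at h2
  have hc : c * c = 1 := by simpa using congrFun₂ h2 0 0
  rcases mul_self_eq_one_iff.mp hc with rfl | rfl
  · rwa [one_smul]
  · rw [neg_smul, one_smul]; exact hT.neg

end HasCliffordRotation

lemma smul_I_mem_pauliSet {M : Matrix (Fin (2 ^ n)) (Fin (2 ^ n)) ℂ} (hM : M ∈ PauliSet n) :
    Complex.I • M ∈ PauliSet n := by
  obtain ⟨c, P, hc, hP, rfl⟩ := hM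
  refine ⟨Complex.I * c, P, ?_, hP, smul_smul _ _ _⟩
  rcases hc with rfl | rfl | rfl | rfl <;> simp

lemma smul_mem_pauliSet {M : Matrix (Fin (2 ^ n)) (Fin (2 ^ n)) ℂ} (hM : M ∈ PauliSet n) {c : ℂ}
    (hc : c ∈ ({1, -1, Complex.I, -Complex.I} : Set ℂ)) : c • M ∈ PauliSet n := by
  have h2 : (-1 : ℂ) • M = Complex.I • Complex.I • M := by rw [smul_smul, Complex.I_mul_I]
  have h3 : (-Complex.I) • M = Complex.I • Complex.I • Complex.I • M := by
    rw [smul_smul, smul_smul, Complex.I_mul_I]; simp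
  rcases hc with rfl | rfl | rfl | rfl
  · rwa [one_smul]
  · rw [h2]; exact smul_I_mem_pauliSet (smul_I_mem_pauliSet hM)
  · exact smul_I_mem_pauliSet hM
  · rw [h3]; exact smul_I_mem_pauliSet (smul_I_mem_pauliSet (smul_I_mem_pauliSet hM))

lemma neg_mem_pauliSet {M : Matrix (Fin (2 ^ n)) (Fin (2 ^ n)) ℂ} (hM : M ∈ PauliSet n) :
    -M ∈ PauliSet n := by
  simpa using smul_mem_pauliSet hM (c := -1) (by simp)

lemma pauliLetters_mul {A B : Matrix (Fin 2) (Fin 2) ℂ} (hA : A ∈ pauliLetters)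
    (hB : B ∈ pauliLetters) : ∃ c ∈ ({1, -1, Complex.I, -Complex.I} : Set ℂ),
      ∃ C ∈ pauliLetters, A * B = c • C := by
  rcases hA with rfl | rfl | rfl | rfl
  · exact ⟨1, by simp, B, hB, by simp⟩
  · rcases hB with rfl | rfl | rfl | rfl
    · exact ⟨1, by simp, PX, by simp [pauliLetters], by simp⟩
    · exact ⟨1, by simp, 1, by simp [pauliLetters], by simp [PX_mul_PX]⟩
    · exact ⟨Complex.I, by simp, PZ, by simp [pauliLetters], PX_mul_PY⟩
    · exact ⟨-Complex.I, by simp, PY, by simp [pauliLetters], by simp [PX_mul_PZ]⟩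
  · rcases hB with rfl | rfl | rfl | rfl
    · exact ⟨1, by simp, PY, by simp [pauliLetters], by simp⟩
    · exact ⟨-Complex.I, by simp, PZ, by simp [pauliLetters], by simp [PY_mul_PX]⟩
    · exact ⟨1, by simp, 1, by simp [pauliLetters], by simp [PY_mul_PY]⟩
    · exact ⟨Complex.I, by simp, PX, by simp [pauliLetters], PY_mul_PZ⟩
  · rcases hB with rfl | rfl | rfl | rfl
    · exact ⟨1, by simp, PZ, by simp [pauliLetters], by simp⟩
    · exact ⟨Complex.I, by simp, PY, by simp [pauliLetters], PZ_mul_PX⟩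
    · exact ⟨-Complex.I, by simp, PX, by simp [pauliLetters], by simp [PZ_mul_PY]⟩
    · exact ⟨1, by simp, 1, by simp [pauliLetters], by simp [PZ_mul_PZ]⟩

lemma pauliLetters_commute_or {A B : Matrix (Fin 2) (Fin 2) ℂ} (hA : A ∈ pauliLetters)
    (hB : B ∈ pauliLetters) : A * B = B * A ∨ A * B = -(B * A) := by
  rcases hA with rfl | rfl | rfl | rfl <;> rcases hB with rfl | rfl | rfl | rfl <;>
    simp [PX_mul_PY, PY_mul_PX, PY_mul_PZ, PZ_mul_PY, PZ_mul_PX, PX_mul_PZ]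

lemma tensorPow_mul_mem_pauliSet : ∀ (n : ℕ) (P Q : Fin n → Matrix (Fin 2) (Fin 2) ℂ)
    (_ : ∀ i, P i ∈ pauliLetters) (_ : ∀ i, Q i ∈ pauliLetters),
    tensorPow n P * tensorPow n Q ∈ PauliSet n
  | 0, _, _, _, _ => ⟨1, fun _ => 1, by simp, fun i => i.elim0, by simp [tensorPow]⟩
  | n + 1, P, Q, hP, hQ => by
    obtain ⟨c, R, hc, hR, h⟩ := tensorPow_mul_mem_pauliSet n (fun i => P i.succ)
      (fun i => Q i.succ) (fun i => hP _) (fun i => hQ _)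
    obtain ⟨d, hd, C, hC, hPQ⟩ := pauliLetters_mul (hP 0) (hQ 0)
    rw [tensorPow_succ, tensorPow_succ, consQubit_mul, h, hPQ, consQubit_smul_left,
      consQubit_smul_right]
    refine smul_mem_pauliSet ⟨c, Fin.cons C R, hc, Fin.cases hC hR, ?_⟩ hd
    rw [tensorPow_succ]
    rfl

lemma mul_mem_pauliSet {M N : Matrix (Fin (2 ^ n)) (Fin (2 ^ n)) ℂ} (hM : M ∈ PauliSet n)
    (hN : N ∈ PauliSet n) : M * N ∈ PauliSet n := by
  obtain ⟨c, P, hc, hP, rfl⟩ := hM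
  obtain ⟨d, Q, hd, hQ, rfl⟩ := hN
  rw [smul_mul_assoc, mul_smul_comm]
  exact smul_mem_pauliSet (smul_mem_pauliSet (tensorPow_mul_mem_pauliSet n P Q hP hQ) hd) hc

lemma tensorPow_commute_or : ∀ (n : ℕ) (P Q : Fin n → Matrix (Fin 2) (Fin 2) ℂ)
    (_ : ∀ i, P i ∈ pauliLetters) (_ : ∀ i, Q i ∈ pauliLetters),
    tensorPow n P * tensorPow n Q = tensorPow n Q * tensorPow n P ∨
      tensorPow n P * tensorPow n Q = -(tensorPow n Q * tensorPow n P)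
  | 0, _, _, _, _ => Or.inl (by simp [tensorPow])
  | n + 1, P, Q, hP, hQ => by
    simp only [tensorPow_succ, consQubit_mul]
    rcases tensorPow_commute_or n (fun i => P i.succ) (fun i => Q i.succ) (fun i => hP _)
      (fun i => hQ _) with h | h <;>
    rcases pauliLetters_commute_or (hP 0) (hQ 0) with h' | h' <;>
    simp [h, h', consQubit_neg_left, consQubit_neg_right]

lemma commute_or_of_mem_pauliSet {M N : Matrix (Fin (2 ^ n)) (Fin (2 ^ n)) ℂ}
    (hM : M ∈ PauliSet n) (hN : N ∈ PauliSet n) : M * N = N * M ∨ M * N = -(N * M) := by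
  obtain ⟨c, P, -, hP, rfl⟩ := hM
  obtain ⟨d, Q, -, hQ, rfl⟩ := hN
  rw [smul_mul_smul_comm, smul_mul_smul_comm, mul_comm d c]
  rcases tensorPow_commute_or n P Q hP hQ with h | h
  · exact Or.inl (by rw [h])
  · exact Or.inr (by rw [h, smul_neg])

lemma exists_clifford_of_anticommute {A B : Matrix (Fin (2 ^ n)) (Fin (2 ^ n)) ℂ}
    (hA : A ∈ PauliSet n) (hB : B ∈ PauliSet n) (hA2 : A * A = 1) (hB2 : B * B = 1)
    (h : A * B = -(B * A)) :
    ∃ u ∈ CliffordGroup n, (u : Matrix (Fin (2 ^ n)) (Fin (2 ^ n)) ℂ) * A = B * u ∧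
      (∀ D, D * A = -(A * D) → D * B = -(B * D) →
        (u : Matrix (Fin (2 ^ n)) (Fin (2 ^ n)) ℂ) * D = D * u) ∧
      ∀ D ∈ PauliSet n, ∃ D' ∈ PauliSet n,
        (u : Matrix (Fin (2 ^ n)) (Fin (2 ^ n)) ℂ) * D = D' * u := by
  have hBABA : B * A * (B * A) = -1 := by
    rw [mul_assoc, ← mul_assoc A, h, neg_mul, mul_neg, mul_assoc B A A, hA2, mul_one, hB2]
  have hBA := mul_mem_pauliSet hB hA
  obtain ⟨-, u, hu, hU⟩ := HasCliffordRotation.of_mem_pauliSet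
    (neg_mem_pauliSet (smul_I_mem_pauliSet hBA))
    (by rw [neg_mul_neg, smul_mul_smul_comm, hBABA, Complex.I_mul_I]; simp)
  replace hU : (u : Matrix (Fin (2 ^ n)) (Fin (2 ^ n)) ℂ) = (Real.sqrt 2 : ℂ)⁻¹ • (1 + B * A) := by
    rw [hU, smul_neg, smul_smul, Complex.I_mul_I]; simp
  refine ⟨u, hu, ?_, fun D hDA hDB => ?_, fun D hD => ?_⟩
  · rw [hU, smul_mul_assoc, mul_smul_comm, add_mul, mul_add, mul_assoc, hA2, ← mul_assoc, hB2,
      one_mul, add_comm]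
  · have : D * (B * A) = B * A * D := by
      rw [← mul_assoc, hDB, neg_mul, mul_assoc, hDA, mul_neg, neg_neg, mul_assoc]
    rw [hU, smul_mul_assoc, mul_smul_comm, add_mul, mul_add, this, one_mul, mul_one]
  · rcases commute_or_of_mem_pauliSet hD hBA with hc | hc
    · exact ⟨D, hD, by
        rw [hU, smul_mul_assoc, mul_smul_comm, add_mul, mul_add, hc, one_mul, mul_one]⟩
    · refine ⟨-(D * (B * A)), neg_mem_pauliSet (mul_mem_pauliSet hD hBA), ?_⟩
      rw [hU, smul_mul_assoc, mul_smul_comm, add_mul, mul_add, mul_one, neg_mul (D * (B * A)),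
        mul_assoc D, hBABA, ← neg_eq_iff_eq_neg.mpr hc]
      simp [add_comm]

lemma exists_clifford_of_mem_pauliSet {P Q P' Q' : Matrix (Fin (2 ^ n)) (Fin (2 ^ n)) ℂ}
    (hP : P ∈ PauliSet n) (hQ : Q ∈ PauliSet n) (hP' : P' ∈ PauliSet n) (hQ' : Q' ∈ PauliSet n)
    (hP2 : P * P = 1) (hQ2 : Q * Q = 1) (hP'2 : P' * P' = 1) (hQ'2 : Q' * Q' = 1)
    (hanti : P * Q = -(Q * P)) (hanti' : P' * Q' = -(Q' * P')) :
    ∃ u ∈ CliffordGroup n, (u : Matrix (Fin (2 ^ n)) (Fin (2 ^ n)) ℂ) * P = P' * u ∧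
      ∀ D ∈ PauliSet n, ∃ D' ∈ PauliSet n,
        (u : Matrix (Fin (2 ^ n)) (Fin (2 ^ n)) ℂ) * D = D' * u := by
  rcases commute_or_of_mem_pauliSet hP hP' with hc | hc
  swap
  · obtain ⟨u, hu, h, -, hD⟩ := exists_clifford_of_anticommute hP hP' hP2 hP'2 hc
    exact ⟨u, hu, h, hD⟩
  obtain ⟨R, hR, hR2, hPR, hRP'⟩ : ∃ R ∈ PauliSet n, R * R = 1 ∧ P * R = -(R * P) ∧
      R * P' = -(P' * R) := by
    rcases commute_or_of_mem_pauliSet hQ hP' with h1 | h1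
    swap
    · exact ⟨Q, hQ, hQ2, hanti, h1⟩
    rcases commute_or_of_mem_pauliSet hP hQ' with h2 | h2
    swap
    · exact ⟨Q', hQ', hQ'2, h2, by rw [hanti', neg_neg]⟩
    have h3 : P * (Q * Q') = -(Q * Q' * P) := by
      rw [← mul_assoc, hanti, neg_mul, mul_assoc, h2, mul_assoc]
    have h4 : Q * Q' * P' = -(P' * (Q * Q')) := by
      rw [← mul_assoc, ← h1, mul_assoc Q P', hanti', mul_neg, neg_neg, mul_assoc]
    have hQQ := mul_mem_pauliSet hQ hQ'
    rcases commute_or_of_mem_pauliSet hQ' hQ with h5 | h5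
    · refine ⟨Q * Q', hQQ, ?_, h3, h4⟩
      rw [mul_assoc, ← mul_assoc Q', h5, mul_assoc, hQ'2, mul_one, hQ2]
    · refine ⟨Complex.I • (Q * Q'), smul_I_mem_pauliSet hQQ, ?_, ?_, ?_⟩
      · rw [smul_mul_smul_comm, mul_assoc, ← mul_assoc Q', h5, neg_mul, mul_assoc, hQ'2, mul_one,
          mul_neg, hQ2, Complex.I_mul_I]
        simp
      · rw [mul_smul_comm, h3, smul_mul_assoc, smul_neg]
      · rw [mul_smul_comm, smul_mul_assoc, h4, smul_neg]
  obtain ⟨u, hu, huP, -, huD⟩ := exists_clifford_of_anticommute hP hR hP2 hR2 hPR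
  obtain ⟨v, hv, hvR, -, hvD⟩ := exists_clifford_of_anticommute hR hP' hR2 hP'2 hRP'
  refine ⟨v * u, mul_mem hv hu, ?_, fun D hD => ?_⟩
  · rw [Units.val_mul, mul_assoc, huP, ← mul_assoc, hvR, mul_assoc]
  · obtain ⟨D', hD', h'⟩ := huD D hD
    obtain ⟨D'', hD'', h''⟩ := hvD D' hD'
    exact ⟨D'', hD'', by rw [Units.val_mul, mul_assoc, h', ← mul_assoc, h'', mul_assoc]⟩

lemma exists_clifford_fixing {P Q Q' : Matrix (Fin (2 ^ n)) (Fin (2 ^ n)) ℂ}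
    (hP : P ∈ PauliSet n) (hQ : Q ∈ PauliSet n) (hQ' : Q' ∈ PauliSet n)
    (hP2 : P * P = 1) (hQ2 : Q * Q = 1) (hQ'2 : Q' * Q' = 1)
    (hanti : P * Q = -(Q * P)) (hanti' : P * Q' = -(Q' * P)) :
    ∃ u ∈ CliffordGroup n, (u : Matrix (Fin (2 ^ n)) (Fin (2 ^ n)) ℂ) * P = P * u ∧
      (u : Matrix (Fin (2 ^ n)) (Fin (2 ^ n)) ℂ) * Q = Q' * u := by
  rcases commute_or_of_mem_pauliSet hQ hQ' with hc | hc
  swap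
  · obtain ⟨u, hu, h, hfix, -⟩ := exists_clifford_of_anticommute hQ hQ' hQ2 hQ'2 hc
    exact ⟨u, hu, hfix P hanti hanti', h⟩
  have hPQ := smul_I_mem_pauliSet (mul_mem_pauliSet hP hQ)
  have hPQ2 : (Complex.I • (P * Q)) * (Complex.I • (P * Q)) = 1 := by
    rw [smul_mul_smul_comm, mul_assoc, ← mul_assoc Q, ← neg_eq_iff_eq_neg.mpr hanti, neg_mul,
      mul_neg, mul_assoc P Q Q, hQ2, mul_one, hP2, Complex.I_mul_I]
    simp
  have hQR : Q * (Complex.I • (P * Q)) = -((Complex.I • (P * Q)) * Q) := by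
    rw [mul_smul_comm, smul_mul_assoc, ← mul_assoc, ← neg_eq_iff_eq_neg.mpr hanti, neg_mul,
      smul_neg]
  have hRQ' : (Complex.I • (P * Q)) * Q' = -(Q' * (Complex.I • (P * Q))) := by
    rw [mul_smul_comm, smul_mul_assoc, mul_assoc, hc, ← mul_assoc, hanti', neg_mul, mul_assoc,
      smul_neg]
  have hPR : P * (Complex.I • (P * Q)) = -((Complex.I • (P * Q)) * P) := by
    rw [mul_smul_comm, smul_mul_assoc, mul_assoc P Q P, ← smul_neg, ← mul_neg, ← hanti]
  obtain ⟨u, hu, huQ, huP, -⟩ := exists_clifford_of_anticommute hQ hPQ hQ2 hPQ2 hQR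
  obtain ⟨v, hv, hvR, hvP, -⟩ := exists_clifford_of_anticommute hPQ hQ' hPQ2 hQ'2 hRQ'
  refine ⟨v * u, mul_mem hv hu, ?_, ?_⟩
  · rw [Units.val_mul, mul_assoc, huP P hanti hPR, ← mul_assoc, hvP P hPR hanti', mul_assoc]
  · rw [Units.val_mul, mul_assoc, huQ, ← mul_assoc, hvR, mul_assoc]

end Clifford

/-- The Clifford group acts transitively on anticommuting pairs of
self-inverse Pauli operators. -/
theorem clifford_transitive_on_pauli_pairs (n : ℕ) (hn : 1 ≤ n)
    (P Q P' Q' : Matrix (Fin (2 ^ n)) (Fin (2 ^ n)) ℂ)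
    (hP : P ∈ PauliSet n) (hQ : Q ∈ PauliSet n)
    (hP' : P' ∈ PauliSet n) (hQ' : Q' ∈ PauliSet n)
    (hP2 : P * P = 1) (hQ2 : Q * Q = 1) (hP'2 : P' * P' = 1) (hQ'2 : Q' * Q' = 1)
    (hanti : P * Q = -(Q * P)) (hanti' : P' * Q' = -(Q' * P')) :
    ∃ C ∈ CliffordGroup n,
      (C : Matrix (Fin (2 ^ n)) (Fin (2 ^ n)) ℂ) * P *
        ((C⁻¹ : GL (Fin (2 ^ n)) ℂ) : Matrix (Fin (2 ^ n)) (Fin (2 ^ n)) ℂ) = P' ∧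
      (C : Matrix (Fin (2 ^ n)) (Fin (2 ^ n)) ℂ) * Q *
        ((C⁻¹ : GL (Fin (2 ^ n)) ℂ) : Matrix (Fin (2 ^ n)) (Fin (2 ^ n)) ℂ) = Q' := by
  obtain ⟨u, hu, huP, huD⟩ := exists_clifford_of_mem_pauliSet hP hQ hP' hQ' hP2 hQ2 hP'2 hQ'2
    hanti hanti'
  obtain ⟨R, hR, huQ⟩ := huD Q hQ
  have hRu : R = u * Q * (u⁻¹ : GL (Fin (2 ^ n)) ℂ) := by
    rw [huQ, mul_assoc, u.mul_inv, mul_one]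
  have hR2 : R * R = 1 := by
    nth_rw 2 [hRu]
    rw [← mul_assoc, ← mul_assoc, ← huQ, mul_assoc _ Q Q, hQ2, mul_one, u.mul_inv]
  have hP'R : P' * R = -(R * P') := by
    have h : P' * R * u = -(R * P') * u := by
      rw [mul_assoc, ← huQ, ← mul_assoc, ← huP, mul_assoc, hanti, mul_neg, ← mul_assoc, huQ,
        mul_assoc, huP, neg_mul, mul_assoc]
    exact u.isUnit.mul_right_cancel h
  obtain ⟨v, hv, hvP, hvR⟩ := exists_clifford_fixing hP' hR hQ' hP'2 hR2 hQ'2 hP'R hanti'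
  refine ⟨v * u, mul_mem hv hu, ?_, ?_⟩ <;> rw [Units.mul_inv_eq_iff_eq_mul, Units.val_mul]
  · rw [mul_assoc, huP, ← mul_assoc, hvP, mul_assoc]
  · rw [mul_assoc, huQ, ← mul_assoc, hvR, mul_assoc]
end
end

section
/- The 2-qubit Clifford group contains exactly 92160 elements, the number predicted by the formula 8·∏_{i=1}^{2} 2(4ⁱ−1)·4ⁱ; that is, the cardinality of Clifford(2) equals 92160. -/
open scoped Matrix Kronecker

noncomputable section

/-- Kronecker product of two 2×2 matrices as a 4×4 matrix. -/
def kron2 (A B : Matrix (Fin 2) (Fin 2) ℂ) : Matrix (Fin 4) (Fin 4) ℂ :=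
  Matrix.reindex finProdFinEquiv finProdFinEquiv (A ⊗ₖ B)

/-- The 2-qubit Clifford group: the subgroup of GL(4, ℂ) generated by
ω·I, H⊗I, I⊗H, S⊗I, I⊗S, and CZ. -/
def Clifford2 : Subgroup (GL (Fin 4) ℂ) :=
  Subgroup.closure
    {u : GL (Fin 4) ℂ | (u : Matrix (Fin 4) (Fin 4) ℂ) ∈
      ({ω • 1, kron2 gH 1, kron2 1 gH, kron2 gS 1, kron2 1 gS, gCZ} :
        Set (Matrix (Fin 4) (Fin 4) ℂ))}

/-- A sign (`true` for `-1`) together with two single-qubit Pauli matrices, where `(x, z)` encodes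
`I`, `X`, `Z`, `Y` as `(0, 0)`, `(1, 0)`, `(0, 1)`, `(1, 1)`. -/
abbrev SignedPauli := Bool × (Bool × Bool) × (Bool × Bool)

def gaussKron (A B : Matrix (Fin 2) (Fin 2) GaussianInt) : Matrix (Fin 4) (Fin 4) GaussianInt :=
  Matrix.reindex finProdFinEquiv finProdFinEquiv (A ⊗ₖ B)

def gaussPauliOne : Bool × Bool → Matrix (Fin 2) (Fin 2) GaussianInt
  | (false, false) => 1
  | (true, false) => !![0, 1; 1, 0]
  | (false, true) => !![1, 0; 0, -1]
  | (true, true) => !![0, ⟨0, -1⟩; ⟨0, 1⟩, 0]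

def gaussSign (s : Bool) : GaussianInt := bif s then -1 else 1

/-- The signed Pauli matrix with Gaussian integer entries. -/
def gaussPauli : SignedPauli → Matrix (Fin 4) (Fin 4) GaussianInt
  | (s, a, b) => gaussSign s • gaussKron (gaussPauliOne a) (gaussPauliOne b)

/-- `√2` times the Hadamard matrix. -/
def gaussH : Matrix (Fin 2) (Fin 2) GaussianInt := !![1, 1; 1, -1]

def gaussS : Matrix (Fin 2) (Fin 2) GaussianInt := !![1, 0; 0, ⟨0, 1⟩]

def gaussCZ : Matrix (Fin 4) (Fin 4) GaussianInt :=
  !![1, 0, 0, 0; 0, 1, 0, 0; 0, 0, 1, 0; 0, 0, 0, -1]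

theorem gaussPauli_injective : Function.Injective gaussPauli := by
  simp only [Function.Injective]
  decide +kernel

/-- The symplectic form: whether two signed Pauli matrices anticommute. -/
def anticomm : SignedPauli → SignedPauli → Bool
  | (_, (x₁, z₁), (x₂, z₂)), (_, (x₁', z₁'), (x₂', z₂')) =>
    ((x₁ && z₁') ^^ (z₁ && x₁')) ^^ ((x₂ && z₂') ^^ (z₂ && x₂'))

/-! ### The permutations of the signed Pauli matrices induced by the gates -/

def permH₁ : Equiv.Perm SignedPauli :=
  Function.Involutive.toPerm (fun (s, (x, z), b) => (s ^^ (x && z), (z, x), b))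
    (by unfold Function.Involutive; decide)

def permH₂ : Equiv.Perm SignedPauli :=
  Function.Involutive.toPerm (fun (s, a, (x, z)) => (s ^^ (x && z), a, (z, x)))
    (by unfold Function.Involutive; decide)

def permS₁ : Equiv.Perm SignedPauli where
  toFun := fun (s, (x, z), b) => (s ^^ (x && z), (x, z ^^ x), b)
  invFun := fun (s, (x, z), b) => (s ^^ (x && !z), (x, z ^^ x), b)
  left_inv := by unfold Function.LeftInverse; decide
  right_inv := by unfold Function.RightInverse Function.LeftInverse; decide

def permS₂ : Equiv.Perm SignedPauli where
  toFun := fun (s, a, (x, z)) => (s ^^ (x && z), a, (x, z ^^ x))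
  invFun := fun (s, a, (x, z)) => (s ^^ (x && !z), a, (x, z ^^ x))
  left_inv := by unfold Function.LeftInverse; decide
  right_inv := by unfold Function.RightInverse Function.LeftInverse; decide

def permCZ : Equiv.Perm SignedPauli :=
  Function.Involutive.toPerm (fun (s, (x₁, z₁), (x₂, z₂)) =>
    (s ^^ (x₁ && x₂ && (z₁ ^^ z₂)), (x₁, z₁ ^^ x₂), (x₂, z₂ ^^ x₁)))
    (by unfold Function.Involutive; decide)

theorem anticomm_gatePerm : ∀ e ∈ [1, permH₁, permH₂, permS₁, permS₂, permCZ],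
    ∀ c d : SignedPauli, anticomm (e c) (e d) = anticomm c d := by
  decide +kernel

theorem gaussSign_xor : ∀ s t, gaussSign (s ^^ t) = gaussSign s * gaussSign t := by decide

theorem gaussKron_mul (A B C D : Matrix (Fin 2) (Fin 2) GaussianInt) :
    gaussKron A B * gaussKron C D = gaussKron (A * C) (B * D) := by
  simp [gaussKron, Matrix.mul_kronecker_mul, Matrix.submatrix_mul_equiv]

theorem gaussKron_smul_left (k : GaussianInt) (A B : Matrix (Fin 2) (Fin 2) GaussianInt) :
    gaussKron (k • A) B = k • gaussKron A B := by
  simp [gaussKron, Matrix.smul_kronecker, Matrix.submatrix_smul]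

theorem gaussKron_smul_right (k : GaussianInt) (A B : Matrix (Fin 2) (Fin 2) GaussianInt) :
    gaussKron A (k • B) = k • gaussKron A B := by
  simp [gaussKron, Matrix.kronecker_smul, Matrix.submatrix_smul]

theorem gaussH_mul_gaussPauliOne : ∀ x z, gaussH * gaussPauliOne (x, z) =
    gaussSign (x && z) • (gaussPauliOne (z, x) * gaussH) := by
  decide +kernel

theorem gaussS_mul_gaussPauliOne : ∀ x z, gaussS * gaussPauliOne (x, z) =
    gaussSign (x && z) • (gaussPauliOne (x, z ^^ x) * gaussS) := by
  decide +kernel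

/-! ### Conjugation of complex Pauli matrices -/

def pauli (c : SignedPauli) : Matrix (Fin 4) (Fin 4) ℂ :=
  GaussianInt.toComplex.mapMatrix (gaussPauli c)

theorem pauli_injective : Function.Injective pauli := fun _ _ h =>
  gaussPauli_injective (Matrix.map_injective
    ((injective_iff_map_eq_zero _).2 fun _ => GaussianInt.toComplex_eq_zero.1) h)

theorem kron2_map (A B : Matrix (Fin 2) (Fin 2) GaussianInt) :
    kron2 (A.map GaussianInt.toComplex) (B.map GaussianInt.toComplex) =
      GaussianInt.toComplex.mapMatrix (gaussKron A B) := by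
  ext i j
  simp [kron2, gaussKron]

theorem kron2_smul_left (k : ℂ) (A B : Matrix (Fin 2) (Fin 2) ℂ) :
    kron2 (k • A) B = k • kron2 A B := by
  ext i j
  simp [kron2, mul_assoc]

theorem kron2_smul_right (k : ℂ) (A B : Matrix (Fin 2) (Fin 2) ℂ) :
    kron2 A (k • B) = k • kron2 A B := by
  ext i j
  simp [kron2, mul_left_comm]

theorem det_kron2 (A B : Matrix (Fin 2) (Fin 2) ℂ) :
    (kron2 A B).det = A.det ^ 2 * B.det ^ 2 := by
  rw [kron2, Matrix.det_reindex_self, Matrix.det_kronecker]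
  simp

theorem gH_eq : gH = (Real.sqrt 2 : ℂ)⁻¹ • gaussH.map GaussianInt.toComplex := by
  rw [gH]
  congr 1
  ext i j
  fin_cases i <;> fin_cases j <;> simp [gaussH]

theorem gS_eq : gS = gaussS.map GaussianInt.toComplex := by
  ext i j
  fin_cases i <;> fin_cases j <;> simp [gS, gaussS, GaussianInt.toComplex_def]

theorem gCZ_eq_s19 : gCZ = GaussianInt.toComplex.mapMatrix gaussCZ := by
  ext i j
  fin_cases i <;> fin_cases j <;> simp [gCZ, gaussCZ]

theorem one_eq_map : (1 : Matrix (Fin 2) (Fin 2) ℂ) =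
    (1 : Matrix (Fin 2) (Fin 2) GaussianInt).map GaussianInt.toComplex := by
  simp

theorem ω_isPrimitiveRoot : IsPrimitiveRoot ω 8 := by
  have h : ω = Complex.exp (2 * Real.pi * Complex.I / (8 : ℕ)) := by
    rw [ω]
    congr 1
    push_cast
    ring
  rw [h]
  exact Complex.isPrimitiveRoot_exp 8 (by norm_num)

theorem det_gH : gH.det = -1 := by
  have h : (Real.sqrt 2 : ℂ) ^ 2 = 2 := by
    rw [← Complex.ofReal_pow, Real.sq_sqrt zero_le_two, Complex.ofReal_ofNat]
  rw [gH, Matrix.det_smul, Matrix.det_fin_two_of, Fintype.card_fin, inv_pow, h]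
  norm_num

theorem det_gS : gS.det = Complex.I := by
  simp [gS, Matrix.det_fin_two_of]

theorem det_gCZ : gCZ.det = -1 := by
  have h : gCZ = Matrix.diagonal ![1, 1, 1, -1] := by
    ext i j
    fin_cases i <;> fin_cases j <;> simp [gCZ]
  rw [h, Matrix.det_diagonal]
  simp [Fin.prod_univ_four]

/-- The generating matrices of the Clifford group. -/
def gates : Set (Matrix (Fin 4) (Fin 4) ℂ) :=
  {ω • 1, kron2 gH 1, kron2 1 gH, kron2 gS 1, kron2 1 gS, gCZ}

theorem det_gate_pow_two {M : Matrix (Fin 4) (Fin 4) ℂ} (hM : M ∈ gates) : M.det ^ 2 = 1 := by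
  obtain rfl | rfl | rfl | rfl | rfl | rfl := hM
  · simp [← pow_mul, ω_isPrimitiveRoot.pow_eq_one]
  all_goals simp [det_kron2, det_gH, det_gS, det_gCZ]

theorem exists_gate {M : Matrix (Fin 4) (Fin 4) ℂ} (hM : M ∈ gates) :
    ∃ u ∈ Clifford2, (u : Matrix (Fin 4) (Fin 4) ℂ) = M := by
  have h : M.det ≠ 0 := fun h => by simpa [h] using det_gate_pow_two hM
  exact ⟨Matrix.GeneralLinearGroup.mkOfDetNeZero M h, Subgroup.subset_closure hM, rfl⟩

theorem det_pow_two_of_mem {u : GL (Fin 4) ℂ} (hu : u ∈ Clifford2) :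
    (u : Matrix (Fin 4) (Fin 4) ℂ).det ^ 2 = 1 := by
  have h : Clifford2 ≤ ((powMonoidHom 2).comp Matrix.GeneralLinearGroup.det).ker :=
    (Subgroup.closure_le _).2 fun v hv => Units.ext (by simpa using det_gate_pow_two hv)
  simpa [Units.ext_iff] using h hu

/-- Conjugation by `M` permutes the signed Pauli matrices by `e`. -/
def Induces (M : Matrix (Fin 4) (Fin 4) ℂ) (e : Equiv.Perm SignedPauli) : Prop :=
  ∀ c, M * pauli c = pauli (e c) * M

theorem Induces.one : Induces 1 1 := fun c => by simp

theorem Induces.smul {M : Matrix (Fin 4) (Fin 4) ℂ} {e : Equiv.Perm SignedPauli}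
    (h : Induces M e) (k : ℂ) : Induces (k • M) e := fun c => by
  rw [Matrix.smul_mul, Matrix.mul_smul, h c]

theorem Induces.mul {M N : Matrix (Fin 4) (Fin 4) ℂ} {e f : Equiv.Perm SignedPauli}
    (hM : Induces M e) (hN : Induces N f) : Induces (M * N) (e * f) := fun c => by
  rw [mul_assoc, hN, ← mul_assoc, hM, mul_assoc, Equiv.Perm.mul_apply]

theorem Induces.inv {u : GL (Fin 4) ℂ} {e : Equiv.Perm SignedPauli} (h : Induces u e) :
    Induces (u⁻¹ : GL (Fin 4) ℂ) e⁻¹ := fun c => by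
  rw [Units.inv_mul_eq_iff_eq_mul, ← mul_assoc, Units.eq_mul_inv_iff_mul_eq, h,
    ← Equiv.Perm.mul_apply, mul_inv_cancel, Equiv.Perm.one_apply]

theorem Induces.unique {u : GL (Fin 4) ℂ} {e f : Equiv.Perm SignedPauli} (he : Induces u e)
    (hf : Induces u f) : e = f :=
  Equiv.ext fun c => pauli_injective (u.isUnit.mul_right_cancel ((he c).symm.trans (hf c)))

theorem Induces.map {A : Matrix (Fin 4) (Fin 4) GaussianInt} {e : Equiv.Perm SignedPauli}
    (h : ∀ c, A * gaussPauli c = gaussPauli (e c) * A) :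
    Induces (GaussianInt.toComplex.mapMatrix A) e := fun c => by
  rw [pauli, pauli, ← map_mul, h, map_mul]

theorem induces_H₁ : Induces (kron2 gH 1) permH₁ := by
  have h (c) : gaussKron gaussH 1 * gaussPauli c = gaussPauli (permH₁ c) * gaussKron gaussH 1 := by
    obtain ⟨s, ⟨x, z⟩, b⟩ := c
    simp [gaussPauli, permH₁, gaussKron_mul, gaussKron_smul_left, gaussH_mul_gaussPauliOne,
      gaussSign_xor, smul_smul]
  rw [gH_eq, one_eq_map, kron2_smul_left, kron2_map]
  exact (Induces.map h).smul _

theorem induces_H₂ : Induces (kron2 1 gH) permH₂ := by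
  have h (c) : gaussKron 1 gaussH * gaussPauli c = gaussPauli (permH₂ c) * gaussKron 1 gaussH := by
    obtain ⟨s, a, ⟨x, z⟩⟩ := c
    simp [gaussPauli, permH₂, gaussKron_mul, gaussKron_smul_right, gaussH_mul_gaussPauliOne,
      gaussSign_xor, smul_smul]
  rw [gH_eq, one_eq_map, kron2_smul_right, kron2_map]
  exact (Induces.map h).smul _

theorem induces_S₁ : Induces (kron2 gS 1) permS₁ := by
  have h (c) : gaussKron gaussS 1 * gaussPauli c = gaussPauli (permS₁ c) * gaussKron gaussS 1 := by
    obtain ⟨s, ⟨x, z⟩, b⟩ := c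
    simp [gaussPauli, permS₁, gaussKron_mul, gaussKron_smul_left, gaussS_mul_gaussPauliOne,
      gaussSign_xor, smul_smul]
  rw [gS_eq, one_eq_map, kron2_map]
  exact Induces.map h

theorem induces_S₂ : Induces (kron2 1 gS) permS₂ := by
  have h (c) : gaussKron 1 gaussS * gaussPauli c = gaussPauli (permS₂ c) * gaussKron 1 gaussS := by
    obtain ⟨s, a, ⟨x, z⟩⟩ := c
    simp [gaussPauli, permS₂, gaussKron_mul, gaussKron_smul_right, gaussS_mul_gaussPauliOne,
      gaussSign_xor, smul_smul]
  rw [gS_eq, one_eq_map, kron2_map]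
  exact Induces.map h

theorem induces_CZ : Induces gCZ permCZ := by
  rw [gCZ_eq_s19]
  exact Induces.map (by decide +kernel)

theorem exists_induces_gate {M : Matrix (Fin 4) (Fin 4) ℂ} (hM : M ∈ gates) :
    ∃ e ∈ [1, permH₁, permH₂, permS₁, permS₂, permCZ], Induces M e := by
  obtain rfl | rfl | rfl | rfl | rfl | rfl := hM
  · exact ⟨1, by simp, Induces.one.smul ω⟩
  · exact ⟨permH₁, by simp, induces_H₁⟩
  · exact ⟨permH₂, by simp, induces_H₂⟩
  · exact ⟨permS₁, by simp, induces_S₁⟩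
  · exact ⟨permS₂, by simp, induces_S₂⟩
  · exact ⟨permCZ, by simp, induces_CZ⟩

theorem exists_induces {u : GL (Fin 4) ℂ} (hu : u ∈ Clifford2) :
    ∃ e : Equiv.Perm SignedPauli, Induces u e ∧
      ∀ c d, anticomm (e c) (e d) = anticomm c d := by
  induction hu using Subgroup.closure_induction with
  | mem u hu =>
    obtain ⟨e, he, h⟩ := exists_induces_gate hu
    exact ⟨e, h, anticomm_gatePerm e he⟩
  | one => exact ⟨1, Induces.one, fun _ _ => rfl⟩
  | mul u v _ _ hu hv =>
    obtain ⟨e, he, he'⟩ := hu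
    obtain ⟨f, hf, hf'⟩ := hv
    exact ⟨e * f, he.mul hf, fun _ _ => (he' _ _).trans (hf' _ _)⟩
  | inv u _ hu =>
    obtain ⟨e, he, he'⟩ := hu
    exact ⟨e⁻¹, he.inv, fun c d => by rw [← he', ← Equiv.Perm.mul_apply, ← Equiv.Perm.mul_apply,
      mul_inv_cancel, Equiv.Perm.one_apply, Equiv.Perm.one_apply]⟩

/-- The action of the Clifford group on the signed Pauli matrices by conjugation. -/
def cliffordPerm : Clifford2 →* Equiv.Perm SignedPauli where
  toFun u := (exists_induces u.2).choose
  map_one' := Induces.unique (u := 1) (exists_induces (one_mem _)).choose_spec.1 Induces.one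
  map_mul' u v := Induces.unique (u := u * v) (exists_induces (u * v).2).choose_spec.1
    ((exists_induces u.2).choose_spec.1.mul (exists_induces v.2).choose_spec.1)

theorem induces_cliffordPerm (u : Clifford2) : Induces (u : GL (Fin 4) ℂ) (cliffordPerm u) :=
  (exists_induces u.2).choose_spec.1

theorem anticomm_of_mem_range {e : Equiv.Perm SignedPauli} (he : e ∈ cliffordPerm.range)
    (c d : SignedPauli) : anticomm (e c) (e d) = anticomm c d := by
  obtain ⟨u, rfl⟩ := he
  exact (exists_induces u.2).choose_spec.2 c d

theorem mem_range_of_induces_gate {M : Matrix (Fin 4) (Fin 4) ℂ} {e : Equiv.Perm SignedPauli}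
    (hM : M ∈ gates) (h : Induces M e) : e ∈ cliffordPerm.range := by
  obtain ⟨u, hu, rfl⟩ := exists_gate hM
  exact ⟨⟨u, hu⟩, (induces_cliffordPerm ⟨u, hu⟩).unique h⟩

theorem permH₁_mem : permH₁ ∈ cliffordPerm.range :=
  mem_range_of_induces_gate (by simp [gates]) induces_H₁

theorem permH₂_mem : permH₂ ∈ cliffordPerm.range :=
  mem_range_of_induces_gate (by simp [gates]) induces_H₂

theorem permS₁_mem : permS₁ ∈ cliffordPerm.range :=
  mem_range_of_induces_gate (by simp [gates]) induces_S₁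

theorem permS₂_mem : permS₂ ∈ cliffordPerm.range :=
  mem_range_of_induces_gate (by simp [gates]) induces_S₂

theorem permCZ_mem : permCZ ∈ cliffordPerm.range :=
  mem_range_of_induces_gate (by simp [gates]) induces_CZ

/-! ### The kernel of the action -/

abbrev pauliX₁ : SignedPauli := (false, (true, false), (false, false))
abbrev pauliZ₁ : SignedPauli := (false, (false, true), (false, false))
abbrev pauliX₂ : SignedPauli := (false, (false, false), (true, false))
abbrev pauliZ₂ : SignedPauli := (false, (false, false), (false, true))

theorem pauliX₁_eq : pauli pauliX₁ = !![0, 0, 1, 0; 0, 0, 0, 1; 1, 0, 0, 0; 0, 1, 0, 0] := by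
  have h : gaussPauli pauliX₁ = !![0, 0, 1, 0; 0, 0, 0, 1; 1, 0, 0, 0; 0, 1, 0, 0] := by
    decide +kernel
  ext i j
  fin_cases i <;> fin_cases j <;> simp [pauli, h]

theorem pauliZ₁_eq : pauli pauliZ₁ = !![1, 0, 0, 0; 0, 1, 0, 0; 0, 0, -1, 0; 0, 0, 0, -1] := by
  have h : gaussPauli pauliZ₁ = !![1, 0, 0, 0; 0, 1, 0, 0; 0, 0, -1, 0; 0, 0, 0, -1] := by
    decide +kernel
  ext i j
  fin_cases i <;> fin_cases j <;> simp [pauli, h]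

theorem pauliX₂_eq : pauli pauliX₂ = !![0, 1, 0, 0; 1, 0, 0, 0; 0, 0, 0, 1; 0, 0, 1, 0] := by
  have h : gaussPauli pauliX₂ = !![0, 1, 0, 0; 1, 0, 0, 0; 0, 0, 0, 1; 0, 0, 1, 0] := by
    decide +kernel
  ext i j
  fin_cases i <;> fin_cases j <;> simp [pauli, h]

theorem pauliZ₂_eq : pauli pauliZ₂ = !![1, 0, 0, 0; 0, -1, 0, 0; 0, 0, 1, 0; 0, 0, 0, -1] := by
  have h : gaussPauli pauliZ₂ = !![1, 0, 0, 0; 0, -1, 0, 0; 0, 0, 1, 0; 0, 0, 0, -1] := by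
    decide +kernel
  ext i j
  fin_cases i <;> fin_cases j <;> simp [pauli, h]

theorem eq_smul_one_of_commute {M : Matrix (Fin 4) (Fin 4) ℂ}
    (hX₁ : M * pauli pauliX₁ = pauli pauliX₁ * M) (hZ₁ : M * pauli pauliZ₁ = pauli pauliZ₁ * M)
    (hX₂ : M * pauli pauliX₂ = pauli pauliX₂ * M) (hZ₂ : M * pauli pauliZ₂ = pauli pauliZ₂ * M) :
    M = M 0 0 • 1 := by
  rw [pauliX₁_eq] at hX₁
  rw [pauliZ₁_eq] at hZ₁
  rw [pauliX₂_eq] at hX₂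
  rw [pauliZ₂_eq] at hZ₂
  simp only [← Matrix.ext_iff, Fin.forall_fin_succ, Matrix.mul_apply, Fin.sum_univ_four] at *
  simp [self_eq_neg, neg_eq_self] at *
  grind

theorem exists_eq_pow_of_commute {u : GL (Fin 4) ℂ} (hu : u ∈ Clifford2)
    (hX₁ : u * pauli pauliX₁ = pauli pauliX₁ * u) (hZ₁ : u * pauli pauliZ₁ = pauli pauliZ₁ * u)
    (hX₂ : u * pauli pauliX₂ = pauli pauliX₂ * u) (hZ₂ : u * pauli pauliZ₂ = pauli pauliZ₂ * u) :
    ∃ k : ℕ, (u : Matrix (Fin 4) (Fin 4) ℂ) = (ω • 1) ^ k := by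
  have h := eq_smul_one_of_commute hX₁ hZ₁ hX₂ hZ₂
  have hdet := det_pow_two_of_mem hu
  rw [h, Matrix.det_smul, Matrix.det_one, mul_one, Fintype.card_fin, ← pow_mul] at hdet
  obtain ⟨k, -, hk⟩ := ω_isPrimitiveRoot.eq_pow_of_pow_eq_one hdet
  exact ⟨k, by rw [h, smul_pow, one_pow, hk]⟩

theorem cliffordPerm_eq_one {e : Equiv.Perm SignedPauli} (he : e ∈ cliffordPerm.range)
    (hX₁ : e pauliX₁ = pauliX₁) (hZ₁ : e pauliZ₁ = pauliZ₁) (hX₂ : e pauliX₂ = pauliX₂)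
    (hZ₂ : e pauliZ₂ = pauliZ₂) : e = 1 := by
  obtain ⟨u, rfl⟩ := he
  have h := induces_cliffordPerm u
  obtain ⟨k, hk⟩ := exists_eq_pow_of_commute u.2 (by rw [h, hX₁]) (by rw [h, hZ₁])
    (by rw [h, hX₂]) (by rw [h, hZ₂])
  refine h.unique ?_
  rw [hk, smul_pow, one_pow]
  exact Induces.one.smul _

theorem card_ker_cliffordPerm : Nat.card cliffordPerm.ker = 8 := by
  obtain ⟨w, hw, hwω⟩ := exists_gate (M := ω • 1) (by simp [gates])
  let z : Clifford2 := ⟨w, hw⟩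
  have hz (k : ℕ) : (((z ^ k : Clifford2) : GL (Fin 4) ℂ) : Matrix (Fin 4) (Fin 4) ℂ) =
      (ω • 1) ^ k := by
    simp [z, hwω]
  have hker : cliffordPerm.ker = Subgroup.zpowers z := by
    refine le_antisymm (fun u hu => ?_) ?_
    · have h (c : SignedPauli) := induces_cliffordPerm u c
      simp only [(MonoidHom.mem_ker).1 hu, Equiv.Perm.one_apply] at h
      obtain ⟨k, hk⟩ := exists_eq_pow_of_commute u.2 (h _) (h _) (h _) (h _)
      refine ⟨k, Subtype.ext (Units.ext ?_)⟩
      rw [hk, ← hz]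
      simp
    · rw [Subgroup.zpowers_le]
      refine (induces_cliffordPerm z).unique ?_
      rw [hwω]
      exact Induces.one.smul ω
  have hpow (k : ℕ) : z ^ k = 1 ↔ ω ^ k = 1 := by
    rw [Subtype.ext_iff, Units.ext_iff, hz, smul_pow, one_pow]
    refine ⟨fun h => by simpa using congr_fun₂ h 0 0, fun h => by simp [h]⟩
  rw [hker, Nat.card_zpowers, ω_isPrimitiveRoot.eq_orderOf]
  exact orderOf_eq_orderOf_iff.2 hpow

/-! ### The image of the action -/

theorem Subgroup.card_eq_card_orbit_mul {G α : Type*} [Group G] [MulAction G α]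
    (H : Subgroup G) (a : α) :
    Nat.card H = (MulAction.orbit H a).ncard *
      Nat.card (H ⊓ MulAction.stabilizer G a : Subgroup G) := by
  have h : MulAction.stabilizer H a = (MulAction.stabilizer G a).subgroupOf H := rfl
  rw [← MulAction.index_stabilizer, ← Subgroup.index_mul_card (MulAction.stabilizer H a), h,
    ← Subgroup.inf_subgroupOf_left,
    Nat.card_congr (Subgroup.subgroupOfEquivOfLe inf_le_left).toEquiv]

/-- Adjoins to `s` its images under the permutations in `L`. -/
def spread {α : Type*} [Fintype α] [DecidableEq α] (L : List (Equiv.Perm α)) (s : Finset α) :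
    Finset α :=
  Finset.univ.filter fun c => c ∈ s ∨ ∃ e ∈ L, e.symm c ∈ s

theorem iterate_spread_subset_orbit {α : Type*} [Fintype α] [DecidableEq α]
    {H : Subgroup (Equiv.Perm α)} {L : List (Equiv.Perm α)} (hL : ∀ e ∈ L, e ∈ H) (a : α) (n : ℕ) :
    ∀ c ∈ (spread L)^[n] {a}, c ∈ MulAction.orbit H a := by
  induction n with
  | zero =>
    intro c hc
    rw [Finset.mem_singleton.1 hc]
    exact MulAction.mem_orbit_self a
  | succ n ih =>
    intro c hc
    rw [Function.iterate_succ_apply', spread, Finset.mem_filter] at hc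
    obtain hc | ⟨e, he, hc⟩ := hc.2
    · exact ih c hc
    · have := MulAction.mem_orbit_of_mem_orbit (⟨e, hL e he⟩ : H) (ih _ hc)
      rwa [Subgroup.mk_smul, Equiv.Perm.smul_def, Equiv.apply_symm_apply] at this

theorem card_eq_card_mul_card_stabilizer {α : Type*} [Fintype α] [DecidableEq α]
    {H : Subgroup (Equiv.Perm α)} {a : α} {L : List (Equiv.Perm α)} {n : ℕ} (p : α → Prop)
    [DecidablePred p] (hp : ∀ e ∈ H, p (e a)) (hL : ∀ e ∈ L, e ∈ H)
    (h : ∀ c, p c → c ∈ (spread L)^[n] {a}) :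
    Nat.card H = (Finset.univ.filter p).card *
      Nat.card (H ⊓ MulAction.stabilizer (Equiv.Perm α) a : Subgroup (Equiv.Perm α)) := by
  have horbit : MulAction.orbit H a = (Finset.univ.filter p : Finset α) := by
    ext c
    rw [Finset.mem_coe, Finset.mem_filter_univ]
    refine ⟨?_, fun hc => iterate_spread_subset_orbit hL a n c (h c hc)⟩
    rintro ⟨e, rfl⟩
    exact hp e e.2
  rw [Subgroup.card_eq_card_orbit_mul H a, horbit, Set.ncard_coe_finset]

set_option synthInstance.maxSize 256 in
theorem card_range_cliffordPerm : Nat.card cliffordPerm.range = 30 * (16 * (6 * 4)) := by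
  have h₁ := permH₁_mem
  have h₂ := permH₂_mem
  have s₁ := permS₁_mem
  have s₂ := permS₂_mem
  have cz := permCZ_mem
  have form {e} (he : e ∈ cliffordPerm.range) := anticomm_of_mem_range he
  have sqrtX₁ := mul_mem (mul_mem h₁ s₁) h₁
  have sqrtX₂ := mul_mem (mul_mem h₂ s₂) h₂
  have cx := mul_mem (mul_mem h₁ cz) h₁
  rw [card_eq_card_mul_card_stabilizer (a := pauliX₁) (n := 8)
      (L := [permH₁, permH₂, permS₁, permS₂, permCZ]) (fun c => ∃ d, anticomm c d = true)
      (fun e he => ⟨e pauliZ₁, by rw [form he]; rfl⟩) ?_ (by decide +kernel),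
    card_eq_card_mul_card_stabilizer (a := pauliZ₁) (n := 6)
      (L := [permH₁ * permS₁ * permH₁, permH₂, permS₂, permH₁ * permCZ * permH₁])
      (fun c => anticomm pauliX₁ c = true) ?_ ?_ (by decide +kernel),
    card_eq_card_mul_card_stabilizer (a := pauliX₂) (n := 5) (L := [permH₂, permS₂])
      (fun c => anticomm pauliX₁ c = false ∧ anticomm pauliZ₁ c = false ∧
        ∃ d, anticomm c d = true) ?_ ?_ (by decide +kernel),
    card_eq_card_mul_card_stabilizer (a := pauliZ₂) (n := 4) (L := [permH₂ * permS₂ * permH₂])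
      (fun c => anticomm pauliX₁ c = false ∧ anticomm pauliZ₁ c = false ∧
        anticomm pauliX₂ c = true) ?_ ?_ (by decide +kernel)]
  · have hbot : cliffordPerm.range ⊓ MulAction.stabilizer (Equiv.Perm SignedPauli) pauliX₁ ⊓
        MulAction.stabilizer (Equiv.Perm SignedPauli) pauliZ₁ ⊓
        MulAction.stabilizer (Equiv.Perm SignedPauli) pauliX₂ ⊓
        MulAction.stabilizer (Equiv.Perm SignedPauli) pauliZ₂ = ⊥ := by
      refine (Subgroup.eq_bot_iff_forall _).2 ?_
      rintro e ⟨⟨⟨⟨he, hX₁⟩, hZ₁⟩, hX₂⟩, hZ₂⟩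
      exact cliffordPerm_eq_one he hX₁ hZ₁ hX₂ hZ₂
    rw [hbot, Subgroup.card_bot, mul_one]
    congr 1
  · rintro e ⟨⟨⟨he, hX₁⟩, hZ₁⟩, hX₂⟩
    refine ⟨?_, ?_, ?_⟩
    · rw [← show e pauliX₁ = pauliX₁ from hX₁, form he]; rfl
    · rw [← show e pauliZ₁ = pauliZ₁ from hZ₁, form he]; rfl
    · rw [← show e pauliX₂ = pauliX₂ from hX₂, form he]; rfl
  · simp only [List.forall_mem_cons, List.not_mem_nil, false_imp_iff, implies_true, and_true]
    exact ⟨⟨⟨sqrtX₂, rfl⟩, rfl⟩, rfl⟩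
  · rintro e ⟨⟨he, hX₁⟩, hZ₁⟩
    refine ⟨?_, ?_, e pauliZ₂, ?_⟩
    · rw [← show e pauliX₁ = pauliX₁ from hX₁, form he]; rfl
    · rw [← show e pauliZ₁ = pauliZ₁ from hZ₁, form he]; rfl
    · rw [form he]; rfl
  · simp only [List.forall_mem_cons, List.not_mem_nil, false_imp_iff, implies_true, and_true]
    exact ⟨⟨⟨h₂, rfl⟩, rfl⟩, ⟨s₂, rfl⟩, rfl⟩
  · rintro e ⟨he, hX₁⟩
    rw [← show e pauliX₁ = pauliX₁ from hX₁, form he]; rfl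
  · simp only [List.forall_mem_cons, List.not_mem_nil, false_imp_iff, implies_true, and_true]
    exact ⟨⟨sqrtX₁, rfl⟩, ⟨h₂, rfl⟩, ⟨s₂, rfl⟩, cx, rfl⟩
  · simp only [List.forall_mem_cons, List.not_mem_nil, false_imp_iff, implies_true, and_true]
    exact ⟨h₁, h₂, s₁, s₂, cz⟩

/-- The 2-qubit Clifford group has exactly 92160 elements. -/
theorem clifford2_card : Nat.card Clifford2 = 92160 := by
  rw [← Subgroup.card_mul_index cliffordPerm.ker, Subgroup.index_ker, card_ker_cliffordPerm,
    card_range_cliffordPerm]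
end
end
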